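/- Fix N ≥ 2. Let R̂ = ℂ[X_1,…,X_n] with each X_i homogeneous of positive integer degree, and let R be a graded commutative unital R̂-algebra. Let a_1,…,a_k, b_1,…,b_k be homogeneous elements of R with deg a_j + deg b_j = 2N+2 for all j and Σ_{j=1}^k a_j b_j = w ∈ R̂. Suppose that for some 1 ≤ l ≤ k the pair (R, {a_1,…,a_l}) is a nice pair over R̂. Let R′ := R/(a_1,…,a_l) and P : R → R′ the quotient map. Then the Koszul matrix factorization ((a_1,b_1); …; (a_k,b_k))_R is isomorphic in the homotopy category of graded matrix factorizations over R̂ with potential w to ((P(a_{l+1}),P(b_{l+1})); …; (P(a_k),P(b_k)))_{R′} with its quantum grading shifted up by l(N+1) − Σ_{i=1}^{l} deg a_i and with its ℤ/2-grading shifted by l (i.e., the roles of the even and odd parts are interchanged l times). -/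

import Mathlib

/-!
Statement 16: Let `R̂ = ℂ[X_1,…,X_n]` with `X_i` homogeneous of positive degree, `R` a
graded commutative unital `R̂`-algebra, and `a_1,…,a_k, b_1,…,b_k` homogeneous elements of
`R` with `deg a_j + deg b_j = 2N+2` and `Σ a_j b_j = w ∈ R̂`.  If `(R, {a_1,…,a_l})` is a
nice pair over `R̂` (here `k = l + r`), then the Koszul factorization
`((a_1,b_1);…;(a_k,b_k))_R` is isomorphic in the homotopy category of graded matrix
factorizations over `R̂` with potential `w` to
`((P(a_{l+1}),P(b_{l+1}));…;(P(a_k),P(b_k)))_{R/(a_1,…,a_l)}` with its quantum grading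
shifted up by `s = l(N+1) − Σ_{i=1}^l deg a_i` and its ℤ/2-grading shifted by `l`.

The Koszul factorization of `((a_1,b_1);…;(a_k,b_k))` is modeled on the free module over
the `2^k` basis vectors `e_v`, `v : Fin k → Bool`, with the single (ℤ/2-odd) Koszul
differential; the ℤ/2-grading is by the parity of `v`, and the polynomial grading gives
`e_v` the degree `Σ_{i : v i} (N+1−deg a_i)`.  A homotopy equivalence of graded matrix
factorizations consists of mutually inverse-up-to-(odd)-homotopy `R̂`-linear morphisms
commuting with the differentials and preserving both the ℤ/2-grading and the polynomial
grading.
-/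

open MvPolynomial

/-- The Koszul differential of the sequence `((a_1,b_1);…;(a_k,b_k))` on the free module
with basis `e_v`, `v : Fin k → Bool`:
`(D x) v = Σ_i (−1)^{#{j<i | v j}} (if v i then a i else b i) · x (v with i flipped)`. -/
noncomputable def koszulD {R : Type*} [CommRing R] {k : ℕ} (a b : Fin k → R) :
    ((Fin k → Bool) → R) → ((Fin k → Bool) → R) := fun x v =>
  ∑ i : Fin k,
    (-1 : R) ^ ((Finset.univ.filter fun j => j < i ∧ v j = true).card) *
      (if v i then a i else b i) * x (Function.update v i (!v i))

/-- The polynomial degree of the Koszul basis vector `e_v`. -/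
def koszulDeg {k : ℕ} (dega : Fin k → ℤ) (N : ℕ) (v : Fin k → Bool) : ℤ :=
  ∑ i ∈ Finset.univ.filter (fun i => v i = true), ((N : ℤ) + 1 - dega i)

/-- The ℤ/2-degree (parity) of the Koszul basis vector `e_v`. -/
def parityK {k : ℕ} (v : Fin k → Bool) : ZMod 2 :=
  ((Finset.univ.filter fun i => v i = true).card : ZMod 2)

/-- The set of homogeneous elements of polynomial degree `g` of the Koszul module, for a
ring graded by `ℛ`. -/
def DegSet {R : Type*} [CommRing R] [Module ℂ R] (ℛ : ℤ → Submodule ℂ R) {k : ℕ}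
    (dega : Fin k → ℤ) (N : ℕ) (g : ℤ) : Set ((Fin k → Bool) → R) :=
  {x | ∀ v, x v ∈ ℛ (g - koszulDeg dega N v)}

section Contraction

variable {n : ℕ} {R : Type*} [CommRing R] [Algebra ℂ R] [Algebra (MvPolynomial (Fin n) ℂ) R]
  (ℛ : ℤ → Submodule ℂ R) [GradedAlgebra ℛ]

/-- The degree `e` homogeneous component of a linear endomorphism over the polynomial ring. -/
theorem exists_homogeneous_component [IsScalarTower ℂ (MvPolynomial (Fin n) ℂ) R]
    {wt : Fin n → ℤ}
    (hX : ∀ t, algebraMap (MvPolynomial (Fin n) ℂ) R (X t) ∈ ℛ (wt t))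
    (f : R →ₗ[MvPolynomial (Fin n) ℂ] R) (e : ℤ) :
    ∃ g : R →ₗ[MvPolynomial (Fin n) ℂ] R,
      ∀ i, ∀ x ∈ ℛ i, g x = (DirectSum.decompose ℛ (f x) (i + e) : R) := by
  let g₀ : R →ₗ[ℂ] R := (DirectSum.toModule ℂ ℤ R fun i =>
    (GradedAlgebra.proj ℛ (i + e)) ∘ₗ (f.restrictScalars ℂ) ∘ₗ (ℛ i).subtype) ∘ₗ
      (DirectSum.decomposeLinearEquiv ℛ).toLinearMap
  have hg₀ : ∀ i, ∀ x ∈ ℛ i, g₀ x = (DirectSum.decompose ℛ (f x) (i + e) : R) := by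
    intro i x hx
    rw [LinearMap.comp_apply, LinearEquiv.coe_coe, DirectSum.decomposeLinearEquiv_apply,
      DirectSum.decompose_of_mem ℛ hx, ← DirectSum.lof_eq_of ℂ, DirectSum.toModule_lof]
    rfl
  have hsmulX : ∀ t x, g₀ ((X t : MvPolynomial (Fin n) ℂ) • x) =
      (X t : MvPolynomial (Fin n) ℂ) • g₀ x := by
    intro t x
    induction x using DirectSum.Decomposition.inductionOn ℛ with
    | zero => simp
    | @homogeneous i x =>
      rw [hg₀ i x x.2, hg₀ (wt t + i) _ (by
        rw [Algebra.smul_def]; exact SetLike.mul_mem_graded (hX t) x.2), map_smul,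
        Algebra.smul_def, Algebra.smul_def, add_assoc,
        DirectSum.coe_decompose_mul_add_of_left_mem ℛ (hX t)]
    | add x y hx hy => rw [smul_add, map_add, hx, hy, map_add, smul_add]
  refine ⟨{ toFun := g₀, map_add' := map_add g₀, map_smul' := ?_ }, hg₀⟩
  intro p
  induction p using MvPolynomial.induction_on with
  | C c =>
    intro x
    have h : ∀ y : R, (C c : MvPolynomial (Fin n) ℂ) • y = c • y := fun y => by
      rw [← MvPolynomial.algebraMap_eq, algebraMap_smul]
    simp [h]
  | add p q hp hq => intro x; simp only [add_smul, map_add, hp x, hq x, RingHom.id_apply]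
  | mul_X p t hp => intro x; simp only [mul_smul, hp, hsmulX, RingHom.id_apply]

/-- Graded Nakayama: a degree-preserving endomorphism congruent to the identity modulo the
positive degree variables is invertible when the grading is bounded below. -/
theorem exists_inverse_of_congr_id {wt : Fin n → ℤ} (hwt : ∀ t, 0 < wt t)
    (hX : ∀ t, algebraMap (MvPolynomial (Fin n) ℂ) R (X t) ∈ ℛ (wt t))
    (hbdd : ∃ g₀ : ℤ, ∀ g < g₀, ℛ g = ⊥)
    (u : R →ₗ[MvPolynomial (Fin n) ℂ] R) (hu : ∀ i, ∀ x ∈ ℛ i, u x ∈ ℛ i)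
    (hucongr : ∀ i, ∀ x ∈ ℛ i, ∃ c : Fin n → R, (∀ t, c t ∈ ℛ (i - wt t)) ∧
      u x - x = ∑ t, (X t : MvPolynomial (Fin n) ℂ) • c t) :
    ∃ v : R →ₗ[MvPolynomial (Fin n) ℂ] R, (∀ x, v (u x) = x) ∧ ∀ i, ∀ x ∈ ℛ i, v x ∈ ℛ i := by
  obtain ⟨g₀, hg₀⟩ := hbdd
  have hnil : ∀ m : ℕ, ∀ i : ℤ, i < g₀ + m → ∀ x ∈ ℛ i, ((u - 1) ^ m) x = 0 := by
    intro m
    induction m with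
    | zero =>
      intro i hi x hx
      rw [hg₀ i (by simpa using hi)] at hx
      simpa using hx
    | succ m ih =>
      intro i hi x hx
      obtain ⟨c, hc, hcx⟩ := hucongr i x hx
      have : (u - 1) x = u x - x := rfl
      rw [pow_succ, Module.End.mul_apply, this, hcx, map_sum]
      refine Finset.sum_eq_zero fun t _ => ?_
      rw [map_smul, ih (i - wt t) (by have := hwt t; push_cast at hi; linarith) _ (hc t), smul_zero]
  have hinj : ∀ i, ∀ x ∈ ℛ i, u x = 0 → x = 0 := by
    intro i x hx h0
    have key : ∀ m : ℕ, ((u - 1) ^ m) x = (-1 : ℤ) ^ m • x := by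
      intro m
      induction m with
      | zero => simp
      | succ m ih =>
        have : (u - 1) x = -x := by simp [h0]
        rw [pow_succ, Module.End.mul_apply, this, map_neg, ih, pow_succ]
        simp
    have h := hnil (i - g₀ + 1).toNat i (by have := Int.self_le_toNat (i - g₀ + 1); linarith) x hx
    rw [key] at h
    rcases neg_one_pow_eq_or ℤ (i - g₀ + 1).toNat with h' | h' <;> simpa [h'] using h
  have hsurj : ∀ m : ℕ, ∀ i : ℤ, i < g₀ + m → ∀ x ∈ ℛ i, ∃ y ∈ ℛ i, u y = x := by
    intro m
    induction m with
    | zero =>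
      intro i hi x hx
      rw [hg₀ i (by simpa using hi)] at hx
      exact ⟨0, zero_mem _, by simpa using hx.symm⟩
    | succ m ih =>
      intro i hi x hx
      obtain ⟨c, hc, hcx⟩ := hucongr i x hx
      choose z hz hzu using fun t => ih (i - wt t)
        (by have := hwt t; push_cast at hi; linarith) (c t) (hc t)
      have hsum : u (x - ∑ t, (X t : MvPolynomial (Fin n) ℂ) • z t) = x := by
        rw [map_sub, map_sum]
        simp only [map_smul, hzu]
        rw [← hcx]; abel
      refine ⟨_, sub_mem hx (sum_mem fun t _ => ?_), hsum⟩
      rw [Algebra.smul_def]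
      simpa using SetLike.mul_mem_graded (hX t) (hz t)
  have hcomp : ∀ x i, u (DirectSum.decompose ℛ x i) = DirectSum.decompose ℛ (u x) i := by
    intro x i
    induction x using DirectSum.Decomposition.inductionOn ℛ with
    | zero => simp
    | @homogeneous j x =>
      rw [DirectSum.decompose_coe, DirectSum.decompose_of_mem ℛ (hu j x x.2)]
      by_cases h : j = i
      · subst h; simp
      · rw [DirectSum.of_eq_of_ne _ _ _ (Ne.symm h), DirectSum.of_eq_of_ne _ _ _ (Ne.symm h)]
        simp
    | add x y hx hy => simp [hx, hy]
  have hbij : Function.Bijective u := by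
    refine ⟨(injective_iff_map_eq_zero u).2 fun x hx => ?_, fun x => ?_⟩
    · refine (DirectSum.decompose ℛ).injective (DFinsupp.ext fun i => Subtype.ext ?_)
      simpa using hinj i _ (SetLike.coe_mem _) (by rw [hcomp, hx]; simp)
    · induction x using DirectSum.Decomposition.inductionOn ℛ with
      | zero => exact ⟨0, map_zero u⟩
      | @homogeneous i x =>
        obtain ⟨y, -, hy⟩ := hsurj (i - g₀ + 1).toNat i
          (by have := Int.self_le_toNat (i - g₀ + 1); linarith) x x.2
        exact ⟨y, hy⟩
      | add x y hx hy =>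
        obtain ⟨x', rfl⟩ := hx
        obtain ⟨y', rfl⟩ := hy
        exact ⟨x' + y', map_add u x' y'⟩
  refine ⟨(LinearEquiv.ofBijective u hbij).symm, (LinearEquiv.ofBijective u hbij).symm_apply_apply,
    fun i x hx => ?_⟩
  obtain ⟨y, hy, rfl⟩ := hsurj (i - g₀ + 1).toNat i
    (by have := Int.self_le_toNat (i - g₀ + 1); linarith) x hx
  rwa [LinearEquiv.coe_coe, show u y = LinearEquiv.ofBijective u hbij y from rfl,
    LinearEquiv.symm_apply_apply]

/-- The ideal generated by the images of the variables. -/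
def variableIdeal (n : ℕ) (R : Type*) [CommRing R] [Algebra (MvPolynomial (Fin n) ℂ) R] :
    Ideal R :=
  Ideal.span (Set.range fun t : Fin n => algebraMap (MvPolynomial (Fin n) ℂ) R (X t))

/-- A homogeneous element that is regular modulo the variables acts on `R` with a homogeneous
left inverse that is linear over the polynomial ring. -/
theorem exists_homogeneous_leftInverse [IsScalarTower ℂ (MvPolynomial (Fin n) ℂ) R]
    {wt : Fin n → ℤ} (hwt : ∀ t, 0 < wt t)
    (hX : ∀ t, algebraMap (MvPolynomial (Fin n) ℂ) R (X t) ∈ ℛ (wt t))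
    (hbdd : ∃ g₀ : ℤ, ∀ g < g₀, ℛ g = ⊥) [Module.Projective (MvPolynomial (Fin n) ℂ) R]
    {a : R} {d : ℤ} (ha : a ∈ ℛ d)
    (hreg : ∀ x, a * x ∈ variableIdeal n R → x ∈ variableIdeal n R) :
    ∃ g : R →ₗ[MvPolynomial (Fin n) ℂ] R, (∀ x, g (a * x) = x) ∧ ∀ i, ∀ x ∈ ℛ i, g x ∈ ℛ (i - d) := by
  set J := variableIdeal n R with hJ
  obtain ⟨q, hq⟩ := (LinearMap.mulLeft ℂ (Ideal.Quotient.mk J a)).exists_leftInverse_of_injective (by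
    refine LinearMap.ker_eq_bot'.2 fun y => ?_
    obtain ⟨x, rfl⟩ := Ideal.Quotient.mk_surjective y
    rw [LinearMap.mulLeft_apply, ← map_mul, Ideal.Quotient.eq_zero_iff_mem,
      Ideal.Quotient.eq_zero_iff_mem]
    exact hreg x)
  have hXJ : ∀ t (y : R ⧸ J), (X t : MvPolynomial (Fin n) ℂ) • y = 0 := by
    intro t y
    obtain ⟨x, rfl⟩ := Ideal.Quotient.mk_surjective y
    rw [Algebra.smul_def, IsScalarTower.algebraMap_apply _ R, Ideal.Quotient.algebraMap_eq,
      ← map_mul, Ideal.Quotient.eq_zero_iff_mem]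
    exact Ideal.mul_mem_right _ _ (Ideal.subset_span ⟨t, rfl⟩)
  let q' : (R ⧸ J) →ₗ[MvPolynomial (Fin n) ℂ] (R ⧸ J) :=
    { toFun := q
      map_add' := map_add q
      map_smul' := by
        intro p
        induction p using MvPolynomial.induction_on with
        | C c =>
          intro x
          have h : ∀ y : R ⧸ J, (C c : MvPolynomial (Fin n) ℂ) • y = c • y := fun y => by
            rw [← MvPolynomial.algebraMap_eq, algebraMap_smul]
          simp [h]
        | add p q hp hq => intro x; simp only [add_smul, map_add, hp x, hq x, RingHom.id_apply]
        | mul_X p t hp => intro x; simp only [mul_smul, hXJ, smul_zero, map_zero, RingHom.id_apply] }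
  let π : R →ₗ[MvPolynomial (Fin n) ℂ] (R ⧸ J) :=
    (Ideal.Quotient.mkₐ (MvPolynomial (Fin n) ℂ) J).toLinearMap
  obtain ⟨f, hf⟩ := Module.projective_lifting_property π (q' ∘ₗ π) Ideal.Quotient.mk_surjective
  have hfJ : ∀ x, f (a * x) - x ∈ J := by
    intro x
    rw [← Ideal.Quotient.eq]
    have h₁ : Ideal.Quotient.mk J (f (a * x)) = q (Ideal.Quotient.mk J (a * x)) :=
      LinearMap.congr_fun hf (a * x)
    have h₂ := LinearMap.congr_fun hq (Ideal.Quotient.mk J x)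
    rw [h₁, map_mul]
    exact h₂
  obtain ⟨g, hg⟩ := exists_homogeneous_component ℛ hX f (-d)
  have hgmem : ∀ i, ∀ x ∈ ℛ i, g x ∈ ℛ (i - d) := by
    intro i x hx
    rw [hg i x hx]
    exact SetLike.coe_mem _
  let u : R →ₗ[MvPolynomial (Fin n) ℂ] R := g ∘ₗ LinearMap.mulLeft _ a
  have hu : ∀ i, ∀ x ∈ ℛ i, u x ∈ ℛ i := by
    intro i x hx
    have := hgmem _ _ (SetLike.mul_mem_graded ha hx)
    rwa [add_sub_cancel_left] at this
  obtain ⟨v, hv, hvmem⟩ := exists_inverse_of_congr_id ℛ hwt hX hbdd u hu (by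
    intro i x hx
    obtain ⟨c, hc⟩ := Ideal.mem_span_range_iff_exists_fun.1 (hfJ x)
    refine ⟨fun t => DirectSum.decompose ℛ (c t) (i - wt t), fun t => SetLike.coe_mem _, ?_⟩
    have h₁ : u x = (DirectSum.decompose ℛ (f (a * x)) i : R) := by
      have := hg (d + i) (a * x) (SetLike.mul_mem_graded ha hx)
      rwa [show d + i + -d = i by ring] at this
    have h₂ : u x - x = (DirectSum.decompose ℛ (f (a * x) - x) i : R) := by
      rw [DirectSum.decompose_sub, h₁]
      simp [DirectSum.decompose_of_mem_same ℛ hx]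
    rw [h₂, ← hc, DirectSum.decompose_sum, DFinsupp.finsetSum_apply,
      AddSubmonoidClass.coe_finsetSum]
    refine Finset.sum_congr rfl fun t _ => ?_
    rw [Algebra.smul_def, mul_comm, ← DirectSum.coe_decompose_mul_add_of_left_mem ℛ (hX t),
      add_sub_cancel])
  exact ⟨v ∘ₗ g, hv, fun i x hx => hvmem _ _ (hgmem i x hx)⟩

end Contraction

section Retract

variable {A M M' M'' : Type*} [CommRing A] [AddCommGroup M] [Module A M] [AddCommGroup M']
  [Module A M'] [AddCommGroup M''] [Module A M'']

/-- A strong deformation retract of (curved) complexes, compatible with two families of subsets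
`E` (the parity) and `F` (the degree) up to shifts by `p` and `s`. -/
structure GradedRetract (D : M →ₗ[A] M) (D' : M' →ₗ[A] M') (E : ZMod 2 → Set M)
    (E' : ZMod 2 → Set M') (F : ℤ → Set M) (F' : ℤ → Set M') (p : ZMod 2) (s : ℤ) where
  proj : M →ₗ[A] M'
  incl : M' →ₗ[A] M
  homotopy : M →ₗ[A] M
  proj_comm : ∀ x, proj (D x) = D' (proj x)
  incl_comm : ∀ y, incl (D' y) = D (incl y)
  proj_parity : ∀ c, ∀ x ∈ E c, proj x ∈ E' (c + p)
  incl_parity : ∀ c, ∀ y ∈ E' (c + p), incl y ∈ E c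
  proj_degree : ∀ g, ∀ x ∈ F g, proj x ∈ F' (g - s)
  incl_degree : ∀ g, ∀ y ∈ F' (g - s), incl y ∈ F g
  incl_proj : ∀ x, incl (proj x) - x = D (homotopy x) + homotopy (D x)
  proj_incl : ∀ y, proj (incl y) = y

/-- Composition of graded deformation retracts. -/
def GradedRetract.trans {D : M →ₗ[A] M} {D' : M' →ₗ[A] M'} {D'' : M'' →ₗ[A] M''}
    {E : ZMod 2 → Set M} {E' : ZMod 2 → Set M'} {E'' : ZMod 2 → Set M''}
    {F : ℤ → Set M} {F' : ℤ → Set M'} {F'' : ℤ → Set M''} {p p' : ZMod 2} {s s' : ℤ}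
    (φ : GradedRetract D D' E E' F F' p s) (ψ : GradedRetract D' D'' E' E'' F' F'' p' s') :
    GradedRetract D D'' E E'' F F'' (p + p') (s + s') where
  proj := ψ.proj ∘ₗ φ.proj
  incl := φ.incl ∘ₗ ψ.incl
  homotopy := φ.homotopy + φ.incl ∘ₗ ψ.homotopy ∘ₗ φ.proj
  proj_comm x := by simp [φ.proj_comm, ψ.proj_comm]
  incl_comm y := by simp [φ.incl_comm, ψ.incl_comm]
  proj_parity c x hx := by
    simpa [add_assoc] using ψ.proj_parity _ _ (φ.proj_parity c x hx)
  incl_parity c y hy := φ.incl_parity _ _ (ψ.incl_parity _ _ (by rwa [add_assoc]))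
  proj_degree g x hx := by
    simpa [sub_sub] using ψ.proj_degree _ _ (φ.proj_degree g x hx)
  incl_degree g y hy := φ.incl_degree _ _ (ψ.incl_degree _ _ (by rwa [sub_sub]))
  incl_proj x := by
    have h := congrArg φ.incl (ψ.incl_proj (φ.proj x))
    simp only [map_sub, map_add, φ.incl_comm] at h
    simp only [LinearMap.comp_apply, LinearMap.add_apply, map_add, φ.proj_comm]
    rw [← sub_add_sub_cancel _ (φ.incl (φ.proj x)), h, φ.incl_proj]
    abel
  proj_incl y := by simp [φ.proj_incl, ψ.proj_incl]

/-- A contraction `h` of the kernel of a morphism `G` of matrix factorizations with a module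
section `σ` gives a deformation retract with inclusion `σ - h D σ`. -/
def GradedRetract.ofContraction {D : M →ₗ[A] M} {D' : M' →ₗ[A] M'}
    {E : ZMod 2 → Set M} {E' : ZMod 2 → Set M'} {F : ℤ → Set M} {F' : ℤ → Set M'}
    {p : ZMod 2} {s : ℤ} (w : A) (m : ℤ)
    (hD : ∀ x, D (D x) = w • x)
    (G : M →ₗ[A] M') (σ : M' →ₗ[A] M) (h : M →ₗ[A] M)
    (hGD : ∀ x, G (D x) = D' (G x)) (hGσ : ∀ y, G (σ y) = y) (hGh : ∀ x, G (h x) = 0)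
    (hhσ : ∀ y, h (σ y) = 0) (hker : ∀ x, G x = 0 → D (h x) + h (D x) = x)
    (hEsub : ∀ c, ∀ x ∈ E c, ∀ y ∈ E c, x - y ∈ E c)
    (hFsub : ∀ c, ∀ x ∈ F c, ∀ y ∈ F c, x - y ∈ F c)
    (hDE : ∀ c, ∀ x ∈ E c, D x ∈ E (c + 1)) (hDF : ∀ g, ∀ x ∈ F g, D x ∈ F (g + m))
    (hhE : ∀ c, ∀ x ∈ E (c + 1), h x ∈ E c) (hhF : ∀ g, ∀ x ∈ F (g + m), h x ∈ F g)
    (hGE : ∀ c, ∀ x ∈ E c, G x ∈ E' (c + p)) (hGF : ∀ g, ∀ x ∈ F g, G x ∈ F' (g - s))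
    (hσE : ∀ c, ∀ y ∈ E' (c + p), σ y ∈ E c) (hσF : ∀ g, ∀ y ∈ F' (g - s), σ y ∈ F g) :
    GradedRetract D D' E E' F F' p s where
  proj := G
  incl := σ - h ∘ₗ D ∘ₗ σ
  homotopy := -h
  proj_comm := hGD
  incl_comm y := by
    have hz := hker (D (σ y) - σ (D' y)) (by rw [map_sub, hGD, hGσ, hGσ, sub_self])
    simp only [map_sub, hhσ, hD, map_smul, smul_zero, sub_zero, zero_sub] at hz
    simp only [LinearMap.sub_apply, LinearMap.comp_apply, map_sub]
    rw [← sub_eq_zero] at hz ⊢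
    rw [← hz]
    abel
  proj_parity := hGE
  incl_parity c y hy := hEsub _ _ (hσE c y hy) _ (hhE _ _ (hDE _ _ (hσE c y hy)))
  proj_degree := hGF
  incl_degree g y hy := hFsub _ _ (hσF g y hy) _ (hhF _ _ (hDF _ _ (hσF g y hy)))
  incl_proj x := by
    have hz := hker (x - σ (G x)) (by rw [map_sub, hGσ, sub_self])
    simp only [map_sub, hhσ, sub_zero] at hz
    simp only [LinearMap.sub_apply, LinearMap.comp_apply, LinearMap.neg_apply, map_neg]
    rw [← sub_eq_zero] at hz ⊢
    rw [← hz]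
    abel
  proj_incl y := by simp [hGσ, hGh]

end Retract

section Koszul

variable {R S : Type*} [CommRing R] [CommRing S] {k : ℕ}

theorem koszulD_cons (a b : Fin (k + 1) → R) (x : (Fin (k + 1) → Bool) → R) (c : Bool)
    (v : Fin k → Bool) :
    koszulD a b x (Fin.cons c v) = (if c then a 0 else b 0) * x (Fin.cons (!c) v) +
      (if c then -1 else 1) * koszulD (fun i => a i.succ) (fun i => b i.succ)
        (fun v => x (Fin.cons c v)) v := by
  simp only [koszulD, Fin.sum_univ_succ, Finset.mul_sum]
  congr 1
  · simp
  · refine Finset.sum_congr rfl fun i _ => ?_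
    rw [Fin.card_filter_univ_succ]
    simp only [Fin.cons_zero, Fin.cons_succ, Fin.succ_lt_succ_iff, Fin.succ_pos, true_and,
      Fin.cons_update]
    cases c <;> simp [pow_succ]

theorem parityK_cons (c : Bool) (v : Fin k → Bool) :
    parityK (Fin.cons c v : Fin (k + 1) → Bool) = (if c then 1 else 0) + parityK v := by
  simp only [parityK, Fin.card_filter_univ_succ]
  cases c <;> simp [add_comm]

theorem koszulDeg_cons (dega : Fin (k + 1) → ℤ) (N : ℕ) (c : Bool) (v : Fin k → Bool) :
    koszulDeg dega N (Fin.cons c v : Fin (k + 1) → Bool) =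
      (if c then (N : ℤ) + 1 - dega 0 else 0) + koszulDeg (fun i => dega i.succ) N v := by
  simp only [koszulDeg, Finset.sum_filter, Fin.sum_univ_succ, Fin.cons_zero, Fin.cons_succ]

theorem koszulD_map (P : R →+* S) (a b : Fin k → R) (x : (Fin k → Bool) → R) (v) :
    koszulD (fun i => P (a i)) (fun i => P (b i)) (fun v => P (x v)) v = P (koszulD a b x v) := by
  simp only [koszulD, map_sum, map_mul, map_pow, map_neg, map_one, apply_ite P]

theorem koszulD_add (a b : Fin k → R) (x y : (Fin k → Bool) → R) :
    koszulD a b (x + y) = koszulD a b x + koszulD a b y := by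
  ext v; simp [koszulD, mul_add, Finset.sum_add_distrib]

theorem koszulD_smul {A : Type*} [CommRing A] [Algebra A R] (a b : Fin k → R) (c : A)
    (x : (Fin k → Bool) → R) : koszulD a b (c • x) = c • koszulD a b x := by
  ext v; simp [koszulD, Finset.smul_sum]

/-- The Koszul differential as a linear map. -/
noncomputable def koszulLin (A : Type*) [CommRing A] [Algebra A R] (a b : Fin k → R) :
    ((Fin k → Bool) → R) →ₗ[A] ((Fin k → Bool) → R) where
  toFun := koszulD a b
  map_add' := koszulD_add a b
  map_smul' := koszulD_smul a b

theorem koszulLin_apply (A : Type*) [CommRing A] [Algebra A R] (a b : Fin k → R)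
    (x : (Fin k → Bool) → R) : koszulLin A a b x = koszulD a b x := rfl

theorem koszulD_zero (a b : Fin k → R) : koszulD a b 0 = 0 := map_zero (koszulLin R a b)

theorem koszulD_mul (a b : Fin k → R) (c : R) (x : (Fin k → Bool) → R) (v) :
    koszulD a b (fun v => c * x v) v = c * koszulD a b x v :=
  congrFun (map_smul (koszulLin R a b) c x) v

/-- The Koszul differential squares to the potential. -/
theorem koszulD_koszulD (a b : Fin k → R) (x : (Fin k → Bool) → R) :
    koszulD a b (koszulD a b x) = fun v => (∑ i, a i * b i) * x v := by
  induction k with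
  | zero => ext v; simp [koszulD]
  | succ k ih =>
    ext v
    induction v using Fin.consCases with
    | cons c v =>
      have h : (fun v => koszulD a b x (Fin.cons c v)) =
          (if c then a 0 else b 0) • (fun v => x (Fin.cons (!c) v)) +
          (if c then (-1 : R) else 1) • koszulD (fun i => a i.succ) (fun i => b i.succ)
            (fun v => x (Fin.cons c v)) := by
        ext v; rw [koszulD_cons]; rfl
      rw [koszulD_cons, h, koszulD_add, koszulD_smul, koszulD_smul, ih, koszulD_cons,
        Fin.sum_univ_succ]
      simp only [Pi.add_apply, Pi.smul_apply, smul_eq_mul]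
      cases c <;> simp <;> ring

/-- The sign of the number of entries `true`. -/
def boolSign (R : Type*) [CommRing R] {k : ℕ} (v : Fin k → Bool) : R :=
  (-1) ^ (Finset.univ.filter fun i => v i = true).card

theorem boolSign_cons (c : Bool) (v : Fin k → Bool) :
    boolSign R (Fin.cons c v : Fin (k + 1) → Bool) = (if c then -1 else 1) * boolSign R v := by
  simp only [boolSign, Fin.card_filter_univ_succ]
  cases c <;> simp [pow_succ]

theorem boolSign_mul_self (v : Fin k → Bool) : boolSign R v * boolSign R v = 1 := by
  rw [boolSign, ← mul_pow]; simp

theorem boolSign_mul_mem {σ : Type*} [SetLike σ R] [NegMemClass σ R] {p : σ} {x : R} (hx : x ∈ p)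
    (v : Fin k → Bool) : boolSign R v * x ∈ p := by
  rw [boolSign]
  rcases neg_one_pow_eq_or R (Finset.univ.filter fun i => v i = true).card with h | h <;>
    simpa [h] using hx

theorem koszulD_boolSign_mul (a b : Fin k → R) (x : (Fin k → Bool) → R) (v : Fin k → Bool) :
    koszulD a b (fun v => boolSign R v * x v) v = -(boolSign R v * koszulD a b x v) := by
  induction k with
  | zero => simp [koszulD]
  | succ k ih =>
    induction v using Fin.consCases with
    | cons c v =>
      rw [koszulD_cons, koszulD_cons]
      simp only [boolSign_cons, mul_assoc]
      rw [koszulD_mul, ih]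
      cases c <;> simp <;> ring

/-- The elements of the Koszul module concentrated in parity `c`. -/
def paritySet (R : Type*) [CommRing R] (k : ℕ) (c : ZMod 2) : Set ((Fin k → Bool) → R) :=
  {x | ∀ v, parityK v ≠ c → x v = 0}

theorem koszulD_mem_paritySet (a b : Fin k → R) {c : ZMod 2} {x : (Fin k → Bool) → R}
    (hx : x ∈ paritySet R k c) : koszulD a b x ∈ paritySet R k (c + 1) := by
  induction k generalizing c with
  | zero => intro v _; simp [koszulD]
  | succ k ih =>
    intro v hv
    induction v using Fin.consCases with
    | cons d v =>
      rw [parityK_cons] at hv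
      rw [koszulD_cons, hx _ (by
        rw [parityK_cons]
        rintro rfl
        apply hv
        cases d
        · simp
          grind
        · simp [add_comm]), mul_zero, zero_add]
      have := ih (fun i => a i.succ) (fun i => b i.succ) (c := c + (if d then 1 else 0))
        (x := fun v => x (Fin.cons d v)) (fun v' hv' => hx _ (by
          rw [parityK_cons]
          rintro rfl
          apply hv'
          cases d <;> simp
          grind)) v (by
          contrapose! hv
          rw [hv]
          cases d <;> simp
          grind)
      rw [this, mul_zero]

theorem koszulD_mem_DegSet [Algebra ℂ R] (ℛ : ℤ → Submodule ℂ R) [GradedAlgebra ℛ]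
    {a b : Fin k → R} {dega degb : Fin k → ℤ} {N : ℕ} (ha : ∀ i, a i ∈ ℛ (dega i))
    (hb : ∀ i, b i ∈ ℛ (degb i)) (hdeg : ∀ i, dega i + degb i = 2 * (N : ℤ) + 2) {g : ℤ}
    {x : (Fin k → Bool) → R} (hx : x ∈ DegSet ℛ dega N g) :
    koszulD a b x ∈ DegSet ℛ dega N (g + (N + 1)) := by
  induction k generalizing g with
  | zero => intro v; simp [koszulD]
  | succ k ih =>
    intro v
    induction v using Fin.consCases with
    | cons c v =>
      rw [koszulD_cons, koszulDeg_cons]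
      have h₁ := hx (Fin.cons (!c) v)
      have h₂ := ih (fun i => ha i.succ) (fun i => hb i.succ) (fun i => hdeg i.succ)
        (g := g - if c then (N : ℤ) + 1 - dega 0 else 0) (x := fun v => x (Fin.cons c v))
        (fun v' => by
          have := hx (Fin.cons c v')
          rwa [koszulDeg_cons, ← sub_sub] at this) v
      rw [koszulDeg_cons] at h₁
      have h0 := hdeg 0
      refine add_mem ?_ ?_
      · cases c
        · have := SetLike.mul_mem_graded (hb 0) h₁
          simp only [Bool.not_false, if_true, Bool.false_eq_true, if_false] at this ⊢
          convert this using 2; linarith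
        · have := SetLike.mul_mem_graded (ha 0) h₁
          simp only [Bool.not_true, if_true, Bool.false_eq_true, if_false] at this ⊢
          convert this using 2; linarith
      · rw [show g + ((N : ℤ) + 1) - ((if c then (N : ℤ) + 1 - dega 0 else 0) +
          koszulDeg (fun i => dega i.succ) N v) = g - (if c then (N : ℤ) + 1 - dega 0 else 0) +
            ((N : ℤ) + 1) - koszulDeg (fun i => dega i.succ) N v by ring]
        cases c <;> simpa using h₂

end Koszul

section Induction

variable {n : ℕ}

/-- Restriction of the sets of homogeneous elements to a face of the cube. -/
theorem mem_DegSet_cons {R : Type*} [CommRing R] [Module ℂ R] {ℛ : ℤ → Submodule ℂ R} {k : ℕ}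
    {dega : Fin (k + 1) → ℤ} {N : ℕ} {g : ℤ} {x : (Fin (k + 1) → Bool) → R} :
    x ∈ DegSet ℛ dega N g ↔ ∀ c : Bool, (fun v => x (Fin.cons c v)) ∈
      DegSet ℛ (fun i => dega i.succ) N (g - if c then (N : ℤ) + 1 - dega 0 else 0) := by
  constructor
  · intro h c v
    have := h (Fin.cons c v)
    rwa [koszulDeg_cons, ← sub_sub] at this
  · intro h v
    induction v using Fin.consCases with
    | cons c v =>
      rw [koszulDeg_cons, ← sub_sub]
      exact h c v

/-- Contraction of the first row of a Koszul factorization, given a homogeneous left inverse `g`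
of multiplication by its first entry. -/
noncomputable def koszulRetractFirst {A : Type*} [CommRing A] {R : Type*} [CommRing R]
    [Algebra ℂ R] [Algebra A R] (ℛ : ℤ → Submodule ℂ R) [GradedAlgebra ℛ]
    {S : Type*} [CommRing S] [Algebra ℂ S] [Algebra A S] (𝒮 : ℤ → Submodule ℂ S) (N : ℕ) {k : ℕ}
    {a b : Fin (k + 1) → R} {dega degb : Fin (k + 1) → ℤ} (ha : ∀ i, a i ∈ ℛ (dega i))
    (hb : ∀ i, b i ∈ ℛ (degb i)) (hdeg : ∀ i, dega i + degb i = 2 * (N : ℤ) + 2)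
    (w : A) (hw : ∑ i, a i * b i = algebraMap A R w)
    (P : R →ₐ[A] S) (σ : S →ₗ[A] R) (g : R →ₗ[A] R)
    (hPa : P (a 0) = 0) (hPσ : ∀ y, P (σ y) = y) (hσP : ∀ x, σ (P x) = x - a 0 * g x)
    (hg : ∀ x, g (a 0 * x) = x) (hgmem : ∀ i, ∀ x ∈ ℛ i, g x ∈ ℛ (i - dega 0))
    (hPmem : ∀ i, ∀ x ∈ ℛ i, P x ∈ 𝒮 i) (hσmem : ∀ i, ∀ y ∈ 𝒮 i, σ y ∈ ℛ i) :
    GradedRetract (koszulLin A a b)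
      (koszulLin A (fun i => P (a (Fin.succ i))) (fun i => P (b (Fin.succ i))))
      (paritySet R (k + 1)) (paritySet S k) (DegSet ℛ dega N)
      (DegSet 𝒮 (fun i => dega (Fin.succ i)) N) 1 ((N : ℤ) + 1 - dega 0) :=
  have hgσ : ∀ y, g (σ y) = 0 := fun y => by
    rw [← hPσ y, hσP, map_sub, hg, sub_self]
  let G : ((Fin (k + 1) → Bool) → R) →ₗ[A] ((Fin k → Bool) → S) :=
    { toFun := fun x v => boolSign S v * P (x (Fin.cons true v))
      map_add' := fun x y => by ext v; simp [mul_add]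
      map_smul' := fun c x => by ext v; simp }
  let s : ((Fin k → Bool) → S) →ₗ[A] ((Fin (k + 1) → Bool) → R) :=
    { toFun := fun y v => if v 0 then boolSign R (Fin.tail v) * σ (y (Fin.tail v)) else 0
      map_add' := fun x y => by ext v; cases h : v 0 <;> simp [h, mul_add]
      map_smul' := fun c x => by ext v; cases h : v 0 <;> simp [h] }
  let h : ((Fin (k + 1) → Bool) → R) →ₗ[A] ((Fin (k + 1) → Bool) → R) :=
    { toFun := fun x v => if v 0 then 0 else g (x (Fin.cons true (Fin.tail v)))
      map_add' := fun x y => by ext v; cases h : v 0 <;> simp [h]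
      map_smul' := fun c x => by ext v; cases h : v 0 <;> simp [h] }
  have hG : ∀ x v, G x v = boolSign S v * P (x (Fin.cons true v)) := fun _ _ => rfl
  have hst : ∀ y v, s y (Fin.cons true v) = boolSign R v * σ (y v) := fun _ _ => rfl
  have hsf : ∀ y v, s y (Fin.cons false v) = 0 := fun _ _ => rfl
  have hht : ∀ x v, h x (Fin.cons true v) = 0 := fun _ _ => rfl
  have hhf : ∀ x v, h x (Fin.cons false v) = g (x (Fin.cons true v)) := fun _ _ => rfl
  have hsign : ∀ (v : Fin k → Bool), P (boolSign R v) = boolSign S v := fun v => by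
    simp [boolSign]
  have hgsign : ∀ (v : Fin k → Bool) (x : R), g (boolSign R v * x) = boolSign R v * g x := by
    intro v x
    rw [boolSign]
    rcases neg_one_pow_eq_or R (Finset.univ.filter fun i => v i = true).card with h | h <;>
      simp [h]
  GradedRetract.ofContraction w ((N : ℤ) + 1)
    (fun x => by
      rw [koszulLin_apply, koszulLin_apply, koszulD_koszulD]
      ext v; rw [hw, Pi.smul_apply, Algebra.smul_def])
    G s h
    (fun x => by
      ext v
      rw [koszulLin_apply, koszulLin_apply, hG, koszulD_cons]
      have : G x = fun v => boolSign S v * P (x (Fin.cons true v)) := rfl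
      rw [this, koszulD_boolSign_mul]
      have := koszulD_map P.toRingHom (fun i => a (Fin.succ i)) (fun i => b (Fin.succ i))
        (fun v => x (Fin.cons true v)) v
      simp only [AlgHom.toRingHom_eq_coe, RingHom.coe_coe] at this
      simp [hPa, this])
    (fun y => by
      ext v
      rw [hG, hst, map_mul, hsign, hPσ, ← mul_assoc, boolSign_mul_self, one_mul])
    (fun x => by ext v; rw [hG, hht]; simp)
    (fun y => by
      ext v
      induction v using Fin.consCases with
      | cons c v =>
        cases c
        · rw [hhf, hst, hgsign, hgσ]; simp
        · rw [hht]; rfl)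
    (fun x hx => by
      have hz : ∀ v, a 0 * g (x (Fin.cons true v)) = x (Fin.cons true v) := by
        intro v
        have h₁ : P (x (Fin.cons true v)) = 0 := by
          have h₂ := congrFun hx v
          rw [hG] at h₂
          have h₃ := congrArg (boolSign S v * ·) h₂
          simpa [← mul_assoc, boolSign_mul_self] using h₃
        have h₄ := hσP (x (Fin.cons true v))
        rw [h₁, map_zero] at h₄
        exact (sub_eq_zero.1 h₄.symm).symm
      ext v
      rw [koszulLin_apply, koszulLin_apply, Pi.add_apply]
      induction v using Fin.consCases with
      | cons c v =>
        rw [koszulD_cons]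
        cases c
        · rw [hhf, koszulD_cons]
          have h₅ : (fun v => x (Fin.cons true v)) = fun v => a 0 * g (x (Fin.cons true v)) :=
            funext fun v => (hz v).symm
          rw [h₅, koszulD_mul]
          simp [hht, hhf, hg, map_neg, map_add]
        · rw [hht]
          have h₅ : (fun v => h x (Fin.cons true v)) = 0 := rfl
          rw [h₅, koszulD_zero, Bool.not_true, hhf]
          simp [hz])
    (fun c x hx y hy v hv => by simp [hx v hv, hy v hv])
    (fun c x hx y hy v => sub_mem (hx v) (hy v))
    (fun c x hx => koszulD_mem_paritySet a b hx)
    (fun g x hx => koszulD_mem_DegSet ℛ ha hb hdeg hx)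
    (fun c x hx v hv => by
      induction v using Fin.consCases with
      | cons d v =>
        cases d
        · rw [hhf, hx _ (by
            rw [parityK_cons] at hv ⊢
            contrapose! hv
            simpa [add_comm] using hv), map_zero]
        · exact hht x v)
    (fun i x hx => by
      rw [mem_DegSet_cons] at hx ⊢
      intro c v
      cases c
      · have := hgmem _ _ (hx true v)
        simp only [hhf, if_true, Bool.false_eq_true, if_false] at this ⊢
        convert this using 2
        ring
      · simp [hht])
    (fun c x hx v hv => by
      rw [hG, hx _ (by
        rw [parityK_cons]
        rintro rfl
        apply hv
        simp only [if_true]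
        grind)]
      simp)
    (fun i x hx v => by
      rw [hG]
      exact boolSign_mul_mem (hPmem _ _ (mem_DegSet_cons.1 hx true v)) v)
    (fun c y hy v hv => by
      induction v using Fin.consCases with
      | cons d v =>
        cases d
        · exact hsf y v
        · rw [hst, hy _ (by
            rw [parityK_cons] at hv
            contrapose! hv
            rw [hv]
            simp only [if_true]
            grind)]
          simp)
    (fun i y hy => by
      rw [mem_DegSet_cons]
      intro c v
      cases c
      · simp [hsf]
      · exact boolSign_mul_mem (hσmem _ _ (hy v)) v)

/-- The image grading along a surjection with a section `σ` such that `σ ∘ P` preserves degrees. -/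
@[reducible]
noncomputable def gradedAlgebraOfSection {R S : Type*} [CommRing R] [CommRing S] [Algebra ℂ R]
    [Algebra ℂ S] (ℛ : ℤ → Submodule ℂ R) [GradedAlgebra ℛ] (P : R →ₐ[ℂ] S) (σ : S →+ R)
    (hPσ : ∀ y, P (σ y) = y) (hσP : ∀ i, ∀ x ∈ ℛ i, σ (P x) ∈ ℛ i) :
    GradedAlgebra (fun i => (ℛ i).map P.toLinearMap) where
  one_mem := ⟨1, SetLike.one_mem_graded ℛ, map_one P⟩
  mul_mem := by
    rintro i j _ _ ⟨x, hx, rfl⟩ ⟨y, hy, rfl⟩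
    exact ⟨x * y, SetLike.mul_mem_graded hx hy, map_mul P x y⟩
  toDecomposition :=
    let f : ∀ i, ℛ i →+ (ℛ i).map P.toLinearMap := fun i =>
      (P.toLinearMap.submoduleMap (ℛ i)).toAddMonoidHom
    DirectSum.Decomposition.ofAddHom _
      (((DirectSum.map f).comp (DirectSum.decomposeAddEquiv ℛ).toAddMonoidHom).comp σ)
      (by
        have h : ∀ z, DirectSum.coeAddMonoidHom (fun i => (ℛ i).map P.toLinearMap)
            (DirectSum.map f z) = P (DirectSum.coeAddMonoidHom ℛ z) := by
          intro z
          induction z using DirectSum.induction_on with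
          | zero => simp
          | of i x => simp [f]
          | add x y hx hy => simp only [map_add, hx, hy]
        ext y
        change DirectSum.coeAddMonoidHom (fun i => (ℛ i).map P.toLinearMap)
          (DirectSum.map f (DirectSum.decompose ℛ (σ y))) = y
        rw [h]
        have h' : DirectSum.coeAddMonoidHom ℛ (DirectSum.decompose ℛ (σ y)) = σ y :=
          (DirectSum.decompose ℛ).symm_apply_apply (σ y)
        rw [h', hPσ])
      (by
        refine DirectSum.addHom_ext' fun i => ?_
        ext ⟨_, x, hx, rfl⟩ : 1
        change DirectSum.map f (DirectSum.decompose ℛ (σ (DirectSum.coeAddMonoidHom _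
          (DirectSum.of _ i _)))) = DirectSum.of _ i _
        rw [DirectSum.coeAddMonoidHom_of]
        change DirectSum.map f (DirectSum.decompose ℛ (σ (P x))) = DirectSum.of _ i _
        rw [DirectSum.decompose_of_mem ℛ (hσP i x hx), DirectSum.map_of]
        congr 1
        exact Subtype.ext (hPσ (P x)))

/-- A left inverse of multiplication by `a` yields a section of `R → R ⧸ (a)`. -/
theorem exists_section_of_leftInverse {A R : Type*} [CommRing A] [CommRing R] [Algebra A R]
    {a : R} (g : R →ₗ[A] R) (hg : ∀ x, g (a * x) = x) :
    ∃ σ : (R ⧸ Ideal.span {a}) →ₗ[A] R,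
      (∀ x, σ (Ideal.Quotient.mk (Ideal.span {a}) x) = x - a * g x) ∧
        ∀ y, Ideal.Quotient.mk (Ideal.span {a}) (σ y) = y := by
  let τ : R →ₗ[A] R := LinearMap.id - LinearMap.mulLeft A a ∘ₗ g
  have hτ : (Ideal.span {a}).restrictScalars A ≤ LinearMap.ker τ := by
    intro x hx
    obtain ⟨z, rfl⟩ := Ideal.mem_span_singleton'.1 hx
    simp [τ, mul_comm z a, hg]
  let σ : (R ⧸ Ideal.span {a}) →ₗ[A] R :=
    { toFun := ((Ideal.span {a}).restrictScalars A).liftQ τ hτ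
      map_add' := map_add _
      map_smul' := map_smul _ }
  have hσ : ∀ x, σ (Ideal.Quotient.mk (Ideal.span {a}) x) = x - a * g x := fun _ => rfl
  refine ⟨σ, hσ, fun y => ?_⟩
  obtain ⟨x, rfl⟩ := Ideal.Quotient.mk_surjective y
  rw [hσ, Ideal.Quotient.eq, Ideal.mem_span_singleton']
  exact ⟨-g x, by ring⟩

universe u in
/-- Contraction of the first `l` rows of a Koszul factorization, by induction on `l`. -/
theorem exists_koszulRetract {wt : Fin n → ℤ} (hwt : ∀ t, 0 < wt t) (N r : ℕ)
    {S : Type*} [CommRing S] [Algebra ℂ S] [Algebra (MvPolynomial (Fin n) ℂ) S]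
    [IsScalarTower ℂ (MvPolynomial (Fin n) ℂ) S] (𝒮 : ℤ → Submodule ℂ S) (a' b' : Fin r → S)
    (w : MvPolynomial (Fin n) ℂ) (l : ℕ) :
    ∀ (k : ℕ) (hk : l + r = k) (R : Type u) [CommRing R] [Algebra ℂ R]
      [Algebra (MvPolynomial (Fin n) ℂ) R] [IsScalarTower ℂ (MvPolynomial (Fin n) ℂ) R]
      (ℛ : ℤ → Submodule ℂ R) [GradedAlgebra ℛ] [Module.Projective (MvPolynomial (Fin n) ℂ) R]
      (_ : ∀ t, algebraMap (MvPolynomial (Fin n) ℂ) R (X t) ∈ ℛ (wt t))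
      (_ : ∃ g₀ : ℤ, ∀ g < g₀, ℛ g = ⊥)
      (P : R →ₐ[MvPolynomial (Fin n) ℂ] S) (_ : Function.Surjective P)
      (_ : ∀ i, 𝒮 i = (ℛ i).map (P.restrictScalars ℂ).toLinearMap)
      (a b : Fin k → R) (dega degb : Fin k → ℤ) (_ : ∀ i, a i ∈ ℛ (dega i))
      (_ : ∀ i, b i ∈ ℛ (degb i)) (_ : ∀ i, dega i + degb i = 2 * (N : ℤ) + 2)
      (_ : ∑ i, a i * b i = algebraMap (MvPolynomial (Fin n) ℂ) R w)
      (_ : RingHom.ker P =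
        Ideal.span (Set.range fun i : Fin l => a (Fin.cast hk (Fin.castAdd r i))))
      (_ : ∀ t, a' t = P (a (Fin.cast hk (Fin.natAdd l t))))
      (_ : ∀ t, b' t = P (b (Fin.cast hk (Fin.natAdd l t))))
      (_ : ∀ (i : Fin l) (x : R), a (Fin.cast hk (Fin.castAdd r i)) * x ∈ variableIdeal n R ⊔
          Ideal.span ((fun u : Fin l => a (Fin.cast hk (Fin.castAdd r u))) '' {u | u < i}) →
        x ∈ variableIdeal n R ⊔
          Ideal.span ((fun u : Fin l => a (Fin.cast hk (Fin.castAdd r u))) '' {u | u < i})),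
      Nonempty (GradedRetract (koszulLin (MvPolynomial (Fin n) ℂ) a b)
        (koszulLin (MvPolynomial (Fin n) ℂ) a' b') (paritySet R k) (paritySet S r)
        (DegSet ℛ dega N) (DegSet 𝒮 (fun t => dega (Fin.cast hk (Fin.natAdd l t))) N) (l : ZMod 2)
        ((l : ℤ) * ((N : ℤ) + 1) - ∑ i : Fin l, dega (Fin.cast hk (Fin.castAdd r i)))) := by
  induction l with
  | zero =>
    intro k hk R _ _ _ _ ℛ _ _ hX hbdd P hP h𝒮 a b dega degb ha hb hdeg hw hker ha' hb' hreg
    obtain rfl : r = k := by omega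
    have hcast : ∀ t, Fin.cast hk (Fin.natAdd 0 t) = t := fun t => Fin.ext (by simp)
    simp only [hcast] at ha' hb' ⊢
    have hinj : Function.Injective P := by
      rw [RingHom.injective_iff_ker_eq_bot P, hker]
      simp
    let e := AlgEquiv.ofBijective P ⟨hinj, hP⟩
    have hPe : ∀ y, P (e.symm y) = y := e.apply_symm_apply
    have heP : ∀ x, e.symm (P x) = x := e.symm_apply_apply
    have hcomm : ∀ x v, P (koszulD a b x v) = koszulD a' b' (fun v => P (x v)) v := by
      intro x v
      rw [funext ha', funext hb']
      exact (koszulD_map P.toRingHom a b x v).symm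
    refine ⟨⟨P.toLinearMap.compLeft _, e.symm.toLinearMap.compLeft _, 0,
      ?_, ?_, ?_, ?_, ?_, ?_, ?_, ?_⟩⟩
    · intro x; ext v; exact hcomm x v
    · intro y
      ext v
      apply hinj
      change P (e.symm _) = P (koszulD a b (fun v => e.symm (y v)) v)
      rw [hPe, hcomm]
      simp only [hPe]
      rfl
    · intro c x hx v hv
      change P (x v) = 0
      rw [hx v (by simpa using hv), map_zero]
    · intro c y hy v hv
      change e.symm (y v) = 0
      rw [hy v (by simpa using hv), map_zero]
    · intro g x hx v
      rw [h𝒮]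
      exact ⟨x v, by simpa using hx v, rfl⟩
    · intro g y hy v
      have h := hy v
      rw [h𝒮] at h
      obtain ⟨x, hx, hxy⟩ := h
      change e.symm (y v) ∈ _
      rw [← hxy]
      change e.symm (P x) ∈ _
      rw [heP]
      simpa using hx
    · intro x
      ext v
      simp [heP]
    · intro y
      ext v
      simp [hPe]
  | succ l ih =>
    intro k hk R _ _ _ _ ℛ _ _ hX hbdd P hP h𝒮 a b dega degb ha hb hdeg hw hker ha' hb' hreg
    obtain ⟨k, rfl⟩ : ∃ k', k = k' + 1 := ⟨l + r, by omega⟩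
    have hk' : l + r = k := by omega
    have hcast0 : Fin.cast hk (Fin.castAdd r (0 : Fin (l + 1))) = 0 := Fin.ext (by simp)
    have hcastS : ∀ i : Fin l, Fin.cast hk (Fin.castAdd r i.succ) =
        (Fin.cast hk' (Fin.castAdd r i)).succ := fun i => Fin.ext (by simp)
    have hcastN : ∀ t, Fin.cast hk (Fin.natAdd (l + 1) t) =
        (Fin.cast hk' (Fin.natAdd l t)).succ := fun t => Fin.ext (by simp; omega)
    simp only [hcastN] at ha' hb' ⊢
    obtain ⟨g, hg, hgmem⟩ := exists_homogeneous_leftInverse ℛ hwt hX hbdd (ha 0) (by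
      intro x hx
      have := hreg 0 x (by rw [hcast0]; exact Ideal.mem_sup_left hx)
      simpa using this)
    obtain ⟨σ, hσ, hσs⟩ := exists_section_of_leftInverse g hg
    have hσmk : ∀ i, ∀ x ∈ ℛ i, σ (Ideal.Quotient.mk (Ideal.span {a 0}) x) ∈ ℛ i := by
      intro i x hx
      rw [hσ]
      have := SetLike.mul_mem_graded (ha 0) (hgmem i x hx)
      rw [add_sub_cancel] at this
      exact sub_mem hx this
    let π : R →ₐ[MvPolynomial (Fin n) ℂ] R ⧸ Ideal.span {a 0} := Ideal.Quotient.mkₐ _ _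
    have hπ : Function.Surjective π := Ideal.Quotient.mk_surjective
    have hπa0 : π (a 0) = 0 :=
      Ideal.Quotient.eq_zero_iff_mem.2 (Ideal.mem_span_singleton_self _)
    let 𝒬 : ℤ → Submodule ℂ (R ⧸ Ideal.span {a 0}) := fun i =>
      (ℛ i).map (Ideal.Quotient.mkₐ ℂ (Ideal.span {a 0})).toLinearMap
    let _ : GradedAlgebra 𝒬 := gradedAlgebraOfSection ℛ (Ideal.Quotient.mkₐ ℂ (Ideal.span {a 0}))
      σ.toAddMonoidHom hσs hσmk
    have : Module.Projective (MvPolynomial (Fin n) ℂ) (R ⧸ Ideal.span {a 0}) :=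
      Module.Projective.of_split σ π.toLinearMap (LinearMap.ext hσs)
    have h𝒬mem : ∀ i, ∀ x ∈ ℛ i, π x ∈ 𝒬 i := fun i x hx => ⟨x, hx, rfl⟩
    have φ := koszulRetractFirst ℛ 𝒬 N ha hb hdeg w hw π σ g
      hπa0 hσs hσ hg hgmem h𝒬mem
      (by rintro i _ ⟨x, hx, rfl⟩; exact hσmk i x hx)
    have hPa0 : P (a 0) = 0 := by
      rw [← RingHom.mem_ker, hker]
      exact Ideal.subset_span ⟨0, by simp only [hcast0]⟩
    let P' : (R ⧸ Ideal.span {a 0}) →ₐ[MvPolynomial (Fin n) ℂ] S :=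
      Ideal.Quotient.liftₐ (Ideal.span {a 0}) P (by
        intro x hx
        obtain ⟨z, rfl⟩ := Ideal.mem_span_singleton'.1 hx
        rw [map_mul, hPa0, mul_zero])
    have hP' : ∀ x, P' (π x) = P x := fun _ => rfl
    have hJ : (variableIdeal n R).map π = variableIdeal n (R ⧸ Ideal.span {a 0}) := by
      rw [variableIdeal, variableIdeal, Ideal.map_span, ← Set.range_comp]
      congr 2
    obtain ⟨ψ⟩ := ih k hk' (R ⧸ Ideal.span {a 0}) 𝒬 (fun t => h𝒬mem _ _ (hX t))
      (by
        obtain ⟨g₀, h⟩ := hbdd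
        exact ⟨g₀, fun g hg => by simp only [𝒬, h g hg, Submodule.map_bot]⟩)
      P' (fun y => by obtain ⟨x, rfl⟩ := hP y; exact ⟨π x, rfl⟩)
      (fun i => by rw [h𝒮, ← Submodule.map_comp]; rfl)
      (fun i => π (a i.succ)) (fun i => π (b i.succ)) (fun i => dega i.succ) (fun i => degb i.succ)
      (fun i => h𝒬mem _ _ (ha _)) (fun i => h𝒬mem _ _ (hb _)) (fun i => hdeg _)
      (by
        have := congrArg π hw
        rw [Fin.sum_univ_succ, map_add, map_mul,
          hπa0, zero_mul, zero_add, map_sum, AlgHom.commutes] at this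
        simpa only [map_mul] using this)
      (by
        have h₁ : RingHom.ker P' = (RingHom.ker P).map π := by
          ext y
          obtain ⟨x, rfl⟩ := hπ y
          rw [RingHom.mem_ker, hP', ← RingHom.mem_ker, Ideal.mem_map_iff_of_surjective π hπ]
          constructor
          · exact fun h => ⟨x, h, rfl⟩
          · rintro ⟨x', hx', h⟩
            rw [RingHom.mem_ker] at hx' ⊢
            rw [← hP', ← h, hP', hx']
        rw [h₁, hker, Ideal.map_span, ← Set.range_comp]
        refine le_antisymm (Ideal.span_le.2 ?_) (Ideal.span_mono ?_)
        · rintro _ ⟨i, rfl⟩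
          induction i using Fin.cases with
          | zero =>
            rw [Function.comp_apply, hcast0, hπa0]
            exact zero_mem _
          | succ i =>
            rw [Function.comp_apply, hcastS]
            exact Ideal.subset_span ⟨i, rfl⟩
        · rintro _ ⟨i, rfl⟩
          exact ⟨i.succ, by rw [Function.comp_apply, hcastS]⟩)
      (fun t => ha' t) (fun t => hb' t)
      (by
        intro i y hy
        obtain ⟨x, rfl⟩ := hπ y
        let K := variableIdeal n R ⊔ Ideal.span
          ((fun u : Fin (l + 1) => a (Fin.cast hk (Fin.castAdd r u))) '' {u | u < i.succ})
        have ha0K : Ideal.span {a 0} ≤ K := by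
          rw [Ideal.span_singleton_le_iff_mem]
          exact Ideal.mem_sup_right (Ideal.subset_span ⟨0, Fin.succ_pos i, by simp only [hcast0]⟩)
        have hK : variableIdeal n (R ⧸ Ideal.span {a 0}) ⊔ Ideal.span
            ((fun u : Fin l => π (a (Fin.cast hk' (Fin.castAdd r u)).succ)) '' {u | u < i}) =
            K.map π := by
          rw [Ideal.map_sup, hJ, Ideal.map_span, ← Set.image_comp]
          congr 1
          refine le_antisymm (Ideal.span_mono ?_) (Ideal.span_le.2 ?_)
          · rintro _ ⟨u, hu, rfl⟩
            exact ⟨u.succ, Fin.succ_lt_succ_iff.2 hu, by rw [Function.comp_apply, hcastS]⟩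
          · rintro _ ⟨u, hu, rfl⟩
            induction u using Fin.cases with
            | zero =>
              rw [Function.comp_apply, hcast0, hπa0]
              exact zero_mem _
            | succ u =>
              rw [Function.comp_apply, hcastS]
              exact Ideal.subset_span ⟨u, Fin.succ_lt_succ_iff.1 hu, rfl⟩
        rw [hK, ← map_mul, Ideal.mem_map_iff_of_surjective π hπ] at hy
        obtain ⟨x', hx', hxx⟩ := hy
        rw [hK]
        refine Ideal.mem_map_of_mem π (hreg i.succ x ?_)
        rw [hcastS]
        have := ha0K (Ideal.Quotient.eq.1 hxx)
        simpa using sub_mem hx' this)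
    have hs : (N : ℤ) + 1 - dega 0 + ((l : ℤ) * ((N : ℤ) + 1) -
          ∑ i : Fin l, dega (Fin.cast hk' (Fin.castAdd r i)).succ) =
        ((l + 1 : ℕ) : ℤ) * ((N : ℤ) + 1) -
          ∑ i : Fin (l + 1), dega (Fin.cast hk (Fin.castAdd r i)) := by
      rw [Fin.sum_univ_succ]
      simp only [hcast0, hcastS]
      push_cast
      ring
    have hp : (1 : ZMod 2) + l = ((l + 1 : ℕ) : ZMod 2) := by push_cast; ring
    rw [← hs, ← hp]
    exact ⟨φ.trans ψ⟩

end Induction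

theorem koszul_contraction_nice_pair_a
    (N : ℕ) (hN : 2 ≤ N) (n : ℕ) (wtn : Fin n → ℕ) (hwtn : ∀ i, 0 < wtn i)
    (R : Type*) [CommRing R] [Algebra ℂ R] [Algebra (MvPolynomial (Fin n) ℂ) R]
    [IsScalarTower ℂ (MvPolynomial (Fin n) ℂ) R]
    (ℛ : ℤ → Submodule ℂ R) [GradedAlgebra ℛ]
    (hinj : Function.Injective (algebraMap (MvPolynomial (Fin n) ℂ) R))
    (hgrmap : ∀ (p : MvPolynomial (Fin n) ℂ) (d : ℤ),
      p.IsWeightedHomogeneous (fun i => (wtn i : ℤ)) d →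
        algebraMap (MvPolynomial (Fin n) ℂ) R p ∈ ℛ d)
    (l r : ℕ) (hl : 1 ≤ l)
    (a b : Fin (l + r) → R) (dega degb : Fin (l + r) → ℤ)
    (ha : ∀ i, a i ∈ ℛ (dega i)) (hb : ∀ i, b i ∈ ℛ (degb i))
    (hdeg : ∀ i, dega i + degb i = 2 * (N : ℤ) + 2)
    (w : MvPolynomial (Fin n) ℂ)
    (hpot : ∑ i, a i * b i = algebraMap (MvPolynomial (Fin n) ℂ) R w)
    -- `(R, {b_1,…,b_l})` is a nice pair over `R̂`:
    (hfree : Module.Free (MvPolynomial (Fin n) ℂ) R)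
    (hbddbelow : ∃ g₀ : ℤ, ∀ g < g₀, ℛ g = ⊥)
    (I : Ideal R) (hI : I = Ideal.span (Set.range fun i : Fin l => a (Fin.castAdd r i)))
    (hqfree : Module.Free (MvPolynomial (Fin n) ℂ) (R ⧸ I))
    (hqgraded : DirectSum.IsInternal
      (fun g : ℤ => (ℛ g).map (Ideal.Quotient.mkₐ ℂ I).toLinearMap))
    (J : Ideal R) (hJ : J = Ideal.span (Set.range fun t : Fin n =>
      algebraMap (MvPolynomial (Fin n) ℂ) R (MvPolynomial.X t)))
    (hregular :
      Ideal.span (Set.range fun i : Fin l =>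
          Ideal.Quotient.mk J (a (Fin.castAdd r i))) ≠ ⊤ ∧
        ∀ (i : Fin l) (x : R ⧸ J),
          Ideal.Quotient.mk J (a (Fin.castAdd r i)) * x ∈
              Ideal.span ((fun u : Fin l => Ideal.Quotient.mk J (a (Fin.castAdd r u))) ''
                {u : Fin l | u < i}) →
            x ∈ Ideal.span ((fun u : Fin l => Ideal.Quotient.mk J (a (Fin.castAdd r u))) ''
              {u : Fin l | u < i})) :
    -- conclusion: homotopy equivalence of graded matrix factorizations over `R̂`
    ∃ (G : ((Fin (l + r) → Bool) → R) →ₗ[MvPolynomial (Fin n) ℂ]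
        ((Fin r → Bool) → R ⧸ I))
      (G' : ((Fin r → Bool) → R ⧸ I) →ₗ[MvPolynomial (Fin n) ℂ]
        ((Fin (l + r) → Bool) → R)),
      (∀ x, G (koszulD a b x) =
        koszulD (fun t : Fin r => Ideal.Quotient.mk I (a (Fin.natAdd l t)))
          (fun t : Fin r => Ideal.Quotient.mk I (b (Fin.natAdd l t))) (G x)) ∧
      (∀ y, G' (koszulD (fun t : Fin r => Ideal.Quotient.mk I (a (Fin.natAdd l t)))
          (fun t : Fin r => Ideal.Quotient.mk I (b (Fin.natAdd l t))) y) =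
        koszulD a b (G' y)) ∧
      (∀ (c : ZMod 2) (x : (Fin (l + r) → Bool) → R),
        (∀ v, parityK v ≠ c → x v = 0) →
          ∀ v', parityK v' ≠ c + (l : ZMod 2) → G x v' = 0) ∧
      (∀ (c : ZMod 2) (y : (Fin r → Bool) → R ⧸ I),
        (∀ v', parityK v' ≠ c + (l : ZMod 2) → y v' = 0) →
          ∀ v, parityK v ≠ c → G' y v = 0) ∧
      (∀ g : ℤ, ∀ x ∈ DegSet ℛ dega N g,
        G x ∈ DegSet (fun gg : ℤ => (ℛ gg).map (Ideal.Quotient.mkₐ ℂ I).toLinearMap)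
          (fun t : Fin r => dega (Fin.natAdd l t)) N
          (g - ((l : ℤ) * ((N : ℤ) + 1) - ∑ i : Fin l, dega (Fin.castAdd r i)))) ∧
      (∀ g : ℤ, ∀ y ∈ DegSet (fun gg : ℤ => (ℛ gg).map (Ideal.Quotient.mkₐ ℂ I).toLinearMap)
          (fun t : Fin r => dega (Fin.natAdd l t)) N
          (g - ((l : ℤ) * ((N : ℤ) + 1) - ∑ i : Fin l, dega (Fin.castAdd r i))),
        G' y ∈ DegSet ℛ dega N g) ∧
      (∃ h : ((Fin (l + r) → Bool) → R) →ₗ[MvPolynomial (Fin n) ℂ]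
          ((Fin (l + r) → Bool) → R),
        ∀ x, G' (G x) - x = koszulD a b (h x) + h (koszulD a b x)) ∧
      (∃ h' : ((Fin r → Bool) → R ⧸ I) →ₗ[MvPolynomial (Fin n) ℂ]
          ((Fin r → Bool) → R ⧸ I),
        ∀ y, G (G' y) - y =
          koszulD (fun t : Fin r => Ideal.Quotient.mk I (a (Fin.natAdd l t)))
              (fun t : Fin r => Ideal.Quotient.mk I (b (Fin.natAdd l t))) (h' y) +
            h' (koszulD (fun t : Fin r => Ideal.Quotient.mk I (a (Fin.natAdd l t)))
              (fun t : Fin r => Ideal.Quotient.mk I (b (Fin.natAdd l t))) y)) := by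
  subst hI
  have hregR : ∀ (i : Fin l) (x : R),
      a (Fin.cast rfl (Fin.castAdd r i)) * x ∈ variableIdeal n R ⊔
        Ideal.span ((fun u : Fin l => a (Fin.cast rfl (Fin.castAdd r u))) '' {u | u < i}) →
      x ∈ variableIdeal n R ⊔
        Ideal.span ((fun u : Fin l => a (Fin.cast rfl (Fin.castAdd r u))) '' {u | u < i}) := by
    intro i x hx
    replace hJ : J = variableIdeal n R := hJ
    have hspan : Ideal.span ((fun u : Fin l => Ideal.Quotient.mk J (a (Fin.castAdd r u))) ''
          {u | u < i}) =
        (Ideal.span ((fun u : Fin l => a (Fin.castAdd r u)) '' {u | u < i})).map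
          (Ideal.Quotient.mk J) := by
      rw [Ideal.map_span, ← Set.image_comp]
      rfl
    have h := hregular.2 i (Ideal.Quotient.mk J x)
    rw [← map_mul, hspan, Ideal.mem_quotient_iff_mem_sup, Ideal.mem_quotient_iff_mem_sup,
      sup_comm, hJ] at h
    exact h hx
  obtain ⟨φ⟩ := exists_koszulRetract (wt := fun i => (wtn i : ℤ))
    (fun t => by exact_mod_cast hwtn t) N r
    (fun g => (ℛ g).map (Ideal.Quotient.mkₐ ℂ (Ideal.span
      (Set.range fun i : Fin l => a (Fin.castAdd r i)))).toLinearMap) _ _ w l (l + r) rfl R ℛ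
    (fun t => hgrmap _ _ (isWeightedHomogeneous_X ℂ _ t)) hbddbelow
    (Ideal.Quotient.mkₐ (MvPolynomial (Fin n) ℂ) _) Ideal.Quotient.mk_surjective (fun _ => rfl)
    a b dega degb ha hb hdeg hpot (Ideal.mk_ker) (fun _ => rfl) (fun _ => rfl) hregR
  exact ⟨φ.proj, φ.incl, φ.proj_comm, φ.incl_comm, φ.proj_parity, φ.incl_parity, φ.proj_degree,
    φ.incl_degree, ⟨φ.homotopy, φ.incl_proj⟩, ⟨0, fun y => by
      rw [φ.proj_incl, LinearMap.zero_apply, LinearMap.zero_apply, koszulD_zero, sub_self,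
        add_zero]⟩⟩
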